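/- arXiv:2507.13421 — 2 statements merged into one kernel-verified Lean document; each statement's English description precedes it below -/
import Mathlib

section
/- Two children share n cookies, each cookie having nonnegative amounts of m kinds of frosting (each cookie is an m-tuple of nonnegative reals, and frosting is divisible, i.e., any cookie can be split into two parts in any ratios coordinatewise). Then there is a distribution cutting at most m cookies such that each child receives exactly half of the total of each frosting kind, and each child receives at least ⌊(n−m)/2⌋ uncut cookies. -/
namespace Cookie

/-- value of a boolean -/
noncomputable def val (b : Bool) : ℝ := if b then 1 else 0

/-- face of the splitting polytope -/
def P {n m : ℕ} (v : Fin n → Fin m → ℝ) (S : Finset (Fin n × Bool)) : Set (Fin n → ℝ) :=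
  {x | (∀ i, 0 ≤ x i) ∧ (∀ i, x i ≤ 1) ∧ (∀ k, ∑ i, x i * v i k = (∑ i, v i k) / 2) ∧
    ∀ e ∈ S, x e.1 = val e.2}

/-- free index -/
def Free {n : ℕ} (S : Finset (Fin n × Bool)) (i : Fin n) : Prop := ∀ b, (i, b) ∉ S

/-- boundary of a face -/
def D {n m : ℕ} (v : Fin n → Fin m → ℝ) (S : Finset (Fin n × Bool)) : Set (Fin n → ℝ) :=
  {x | x ∈ P v S ∧ ∃ e : Fin n × Bool, Free S e.1 ∧ x e.1 = val e.2}

/-- constraints -/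
def L {n m : ℕ} (v : Fin n → Fin m → ℝ) (S : Finset (Fin n × Bool)) :
    (Fin n → ℝ) →ₗ[ℝ] (S → ℝ) × (Fin m → ℝ) where
  toFun d := (fun e => d e.1.1, fun k => ∑ i, d i * v i k)
  map_add' x y := by
    ext <;> simp [add_mul, Finset.sum_add_distrib]
  map_smul' c x := by
    ext <;> simp [mul_assoc, Finset.mul_sum]

lemma mem_K {n m : ℕ} {v : Fin n → Fin m → ℝ} {S : Finset (Fin n × Bool)} {d : Fin n → ℝ} :
    d ∈ LinearMap.ker (L v S) ↔ (∀ e ∈ S, d e.1 = 0) ∧ ∀ k, ∑ i, d i * v i k = 0 := by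
  simp [L, funext_iff]

lemma finrank_K {n m : ℕ} (v : Fin n → Fin m → ℝ) (S : Finset (Fin n × Bool)) :
    n ≤ Module.finrank ℝ (LinearMap.ker (L v S)) + (S.card + m) := by
  have h := LinearMap.finrank_range_add_finrank_ker (L v S)
  have h2 := Submodule.finrank_le (LinearMap.range (L v S))
  simp at h h2
  omega

/-- gauge -/
noncomputable def g {n : ℕ} (p : Fin n → ℝ) (d : Fin n → ℝ) (i : Fin n) : ℝ :=
  max (d i / (1 - p i)) (-d i / p i)

lemma radial {n m : ℕ} (hn : 0 < n) (v : Fin n → Fin m → ℝ) (S : Finset (Fin n × Bool))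
    (p : Fin n → ℝ) (hp : p ∈ P v S) (hpD : p ∉ D v S) :
    ∃ f : LinearMap.ker (L v S) → (Fin n → ℝ), ContinuousOn f {0}ᶜ ∧ f '' {0}ᶜ = D v S := by
  obtain ⟨h0, h1, hs, hS⟩ := hp
  have : Nonempty (Fin n) := ⟨⟨0, hn⟩⟩
  have hfree : ∀ i, Free S i → 0 < p i ∧ p i < 1 := by
    intro i hi
    constructor
    · refine lt_of_le_of_ne (h0 i) fun h => hpD ⟨⟨h0, h1, hs, hS⟩, (i, false), hi, ?_⟩
      simp [val, ← h]
    · refine lt_of_le_of_ne (h1 i) fun h => hpD ⟨⟨h0, h1, hs, hS⟩, (i, true), hi, ?_⟩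
      simp [val, ← h]
  have hdz : ∀ d ∈ LinearMap.ker (L v S), ∀ i, ¬ Free S i → d i = 0 := by
    intro d hd i hi
    simp only [Free, not_forall, not_not] at hi
    obtain ⟨b, hb⟩ := hi
    exact (mem_K.1 hd).1 _ hb
  let G : LinearMap.ker (L v S) → ℝ := fun d => Finset.univ.sup' Finset.univ_nonempty (g p d)
  have hGle : ∀ (d : LinearMap.ker (L v S)) i, g p d i ≤ G d := fun d i => Finset.le_sup' (g p d) (Finset.mem_univ i)
  have hGex : ∀ d, ∃ i, G d = g p d i := fun d => by
    obtain ⟨i, -, hi⟩ := Finset.exists_mem_eq_sup' Finset.univ_nonempty (g p d)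
    exact ⟨i, hi⟩
  have hGc : Continuous G := by
    refine Continuous.finset_sup'_apply _ fun i _ => ?_
    unfold g
    have : Continuous fun d : LinearMap.ker (L v S) => (d : Fin n → ℝ) i :=
      (continuous_apply i).comp continuous_subtype_val
    exact (this.div_const _).max (this.neg.div_const _)
  have hGpos : ∀ d, d ≠ 0 → 0 < G d := by
    intro d hd
    have : ∃ i, (d : Fin n → ℝ) i ≠ 0 := by
      by_contra! h
      exact hd (Subtype.ext (funext h))
    obtain ⟨i, hi⟩ := this
    have hf : Free S i := by
      by_contra h
      exact hi (hdz d d.2 i h)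
    obtain ⟨a, b⟩ := hfree i hf
    refine lt_of_lt_of_le ?_ (hGle d i)
    rcases lt_or_gt_of_ne hi with h | h
    · exact lt_max_of_lt_right (div_pos (by linarith) a)
    · exact lt_max_of_lt_left (div_pos h (by linarith))
  refine ⟨fun d => p + (G d)⁻¹ • (d : Fin n → ℝ), ?_, ?_⟩
  · have hi : ContinuousOn (fun d => (G d)⁻¹) {0}ᶜ :=
      hGc.continuousOn.inv₀ fun d hd => (hGpos d hd).ne'
    have hi2 : ContinuousOn (fun d : LinearMap.ker (L v S) => (d : Fin n → ℝ)) {0}ᶜ :=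
      continuous_subtype_val.continuousOn
    exact continuousOn_const.add (hi.smul hi2)
  · ext x
    constructor
    · rintro ⟨d, hd, rfl⟩
      have hG := hGpos d hd
      have hK := mem_K.1 d.2
      have key : ∀ i, Free S i → (d : Fin n → ℝ) i ≤ (1 - p i) * G d ∧
          -(d : Fin n → ℝ) i ≤ p i * G d := by
        intro i hi
        obtain ⟨a, b⟩ := hfree i hi
        have := hGle d i
        obtain ⟨u, w⟩ := max_le_iff.1 this
        rw [div_le_iff₀ (by linarith)] at u w
        constructor <;> linarith
      refine ⟨⟨?_, ?_, ?_, ?_⟩, ?_⟩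
      · intro i
        by_cases hi : Free S i
        · have := (key i hi).2
          have : 0 ≤ (p i * G d + (d : Fin n → ℝ) i) / G d := div_nonneg (by linarith) hG.le
          convert this using 1
          simp; field_simp
        · simp [hdz d d.2 i hi, h0 i]
      · intro i
        by_cases hi : Free S i
        · have := (key i hi).1
          have : (p i * G d + (d : Fin n → ℝ) i) / G d ≤ 1 := by
            rw [div_le_one hG]; linarith
          convert this using 1
          simp; field_simp
        · simp [hdz d d.2 i hi, h1 i]
      · intro k
        have := hK.2 k
        simp only [Pi.add_apply, Pi.smul_apply, smul_eq_mul, add_mul, Finset.sum_add_distrib, hs k,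
          mul_assoc, ← Finset.mul_sum, this]
        simp
      · intro e he
        simp [hK.1 e he, hS e he]
      · obtain ⟨i, hi⟩ := hGex d
        have hne : (d : Fin n → ℝ) i ≠ 0 := by
          intro h
          simp [g, h] at hi
          linarith
        have hf : Free S i := by
          by_contra h
          exact hne (hdz d d.2 i h)
        obtain ⟨a, b⟩ := hfree i hf
        have b' : 1 - p i ≠ 0 := by linarith
        rcases max_choice ((d : Fin n → ℝ) i / (1 - p i)) (-(d : Fin n → ℝ) i / p i) with h | h
        · refine ⟨(i, true), hf, ?_⟩
          rw [g, h] at hi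
          simp only [val, Pi.add_apply, Pi.smul_apply, smul_eq_mul, hi]
          field_simp
          simp
        · refine ⟨(i, false), hf, ?_⟩
          rw [g, h] at hi
          simp only [val, Pi.add_apply, Pi.smul_apply, smul_eq_mul, hi]
          field_simp
          simp
    · rintro ⟨⟨x0, x1, xs, xS⟩, e, he, hxe⟩
      have hd : x - p ∈ LinearMap.ker (L v S) := by
        rw [mem_K]
        refine ⟨fun e he => by simp [xS e he, hS e he], fun k => ?_⟩
        simp [sub_mul, Finset.sum_sub_distrib, xs, hs]
      have hG : G ⟨x - p, hd⟩ = 1 := by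
        apply le_antisymm
        · refine Finset.sup'_le _ _ fun i _ => ?_
          by_cases hi : Free S i
          · obtain ⟨a, b⟩ := hfree i hi
            have := x0 i
            have := x1 i
            refine max_le ?_ ?_
            · rw [div_le_one (by linarith)]; simp; linarith
            · rw [div_le_one (by linarith)]; simp; linarith
          · have := hdz _ hd i hi
            simp only [g, this]
            simp
        · refine le_trans ?_ (hGle _ e.1)
          obtain ⟨a, b⟩ := hfree e.1 he
          have b' : 1 - p e.1 ≠ 0 := by linarith
          obtain ⟨i, t⟩ := e
          cases t
          · refine le_trans (le_of_eq ?_) (le_max_right _ _)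
            simp only [val] at hxe
            simp [hxe, a.ne']
          · refine le_trans (le_of_eq ?_) (le_max_left _ _)
            simp only [val] at hxe
            simp [hxe, b']
      refine ⟨⟨x - p, hd⟩, ?_, ?_⟩
      · intro h
        have h' := congrArg Subtype.val (Set.mem_singleton_iff.1 h)
        have : x = p := by simpa [sub_eq_zero] using h'
        subst this
        exact hpD ⟨⟨x0, x1, xs, xS⟩, e, he, hxe⟩
      · simp [hG]

lemma D_nonempty {n m : ℕ} (v : Fin n → Fin m → ℝ) (S : Finset (Fin n × Bool))
    (hc : S.card + m < n) (hP : (P v S).Nonempty) : (D v S).Nonempty := by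
  obtain ⟨p, hp⟩ := hP
  by_cases hD : p ∈ D v S
  · exact ⟨p, hD⟩
  obtain ⟨f, -, hf⟩ := radial (by omega) v S p hp hD
  rw [← hf, Set.image_nonempty]
  have h := finrank_K v S
  have : Nontrivial (LinearMap.ker (L v S)) := Module.nontrivial_of_finrank_pos (R := ℝ) (by omega)
  obtain ⟨d, hd⟩ := exists_ne (0 : LinearMap.ker (L v S))
  exact ⟨d, hd⟩

lemma P_convex {n m : ℕ} (v : Fin n → Fin m → ℝ) (S : Finset (Fin n × Bool)) :
    Convex ℝ (P v S) := by
  rintro x ⟨x0, x1, xs, xS⟩ y ⟨y0, y1, ys, yS⟩ a b ha hb hab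
  refine ⟨fun i => ?_, fun i => ?_, fun k => ?_, fun e he => ?_⟩
  · have := mul_nonneg ha (x0 i)
    have := mul_nonneg hb (y0 i)
    simp; linarith
  · have := mul_le_mul_of_nonneg_left (x1 i) ha
    have := mul_le_mul_of_nonneg_left (y1 i) hb
    simp; linarith
  · simp only [Pi.add_apply, Pi.smul_apply, smul_eq_mul, add_mul, Finset.sum_add_distrib,
      mul_assoc, ← Finset.mul_sum, xs k, ys k]
    rw [← add_mul, hab, one_mul]
  · simp only [Pi.add_apply, Pi.smul_apply, smul_eq_mul, xS e he, yS e he]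
    rw [← add_mul, hab, one_mul]

lemma D_preconnected {n m : ℕ} (v : Fin n → Fin m → ℝ) (S : Finset (Fin n × Bool))
    (hc : S.card + m + 1 < n) : IsPreconnected (D v S) := by
  by_cases h : P v S ⊆ D v S
  · have : D v S = P v S := Set.Subset.antisymm (fun x hx => hx.1) h
    rw [this]
    exact (P_convex v S).isPreconnected
  · obtain ⟨p, hp, hD⟩ := Set.not_subset.1 h
    obtain ⟨f, hc', hf⟩ := radial (by omega) v S p hp hD
    rw [← hf]
    refine IsPreconnected.image ?_ f hc'
    have h := finrank_K v S
    refine (isConnected_compl_singleton_of_one_lt_rank ?_ 0).isPreconnected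
    rw [← Module.finrank_eq_rank]
    exact_mod_cast (by omega : 1 < Module.finrank ℝ (LinearMap.ker (L v S)))

lemma color {X E : Type*} [TopologicalSpace X] [Finite E] (D : Set X) (hD : IsPreconnected D)
    (Q : E → Set X) (hQ : ∀ e, IsClosed (Q e)) (hcov : D ⊆ ⋃ e, Q e) (c : E → Prop)
    (hc : ∀ e e', (D ∩ (Q e ∩ Q e')).Nonempty → c e → c e') (e e' : E)
    (he : (D ∩ Q e).Nonempty) (he' : (D ∩ Q e').Nonempty) (hce : c e) : c e' := by
  by_contra hce'
  have := isPreconnected_closed_iff.1 hD (⋃ e : {e // c e}, Q e) (⋃ e : {e // ¬ c e}, Q e)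
    (isClosed_iUnion_of_finite fun e => hQ e) (isClosed_iUnion_of_finite fun e => hQ e)
    (fun x hx => by
      obtain ⟨a, ha⟩ := Set.mem_iUnion.1 (hcov hx)
      by_cases h : c a
      · exact Or.inl (Set.mem_iUnion.2 ⟨⟨a, h⟩, ha⟩)
      · exact Or.inr (Set.mem_iUnion.2 ⟨⟨a, h⟩, ha⟩))
    (by obtain ⟨x, hx, hx'⟩ := he
        exact ⟨x, hx, Set.mem_iUnion.2 ⟨⟨e, hce⟩, hx'⟩⟩)
    (by obtain ⟨x, hx, hx'⟩ := he'
        exact ⟨x, hx, Set.mem_iUnion.2 ⟨⟨e', hce'⟩, hx'⟩⟩)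
  obtain ⟨x, hx, h1, h2⟩ := this
  obtain ⟨⟨a, ha⟩, h1⟩ := Set.mem_iUnion.1 h1
  obtain ⟨⟨b, hb⟩, h2⟩ := Set.mem_iUnion.1 h2
  exact hb (hc a b ⟨x, hx, h1, h2⟩ ha)

lemma P_insert {n m : ℕ} {v : Fin n → Fin m → ℝ} {S : Finset (Fin n × Bool)} {x : Fin n → ℝ}
    {e : Fin n × Bool} : x ∈ P v (insert e S) ↔ x ∈ P v S ∧ x e.1 = val e.2 := by
  simp only [P, Set.mem_ofPred_eq, Finset.forall_mem_insert]
  tauto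

lemma P_mono {n m : ℕ} {v : Fin n → Fin m → ℝ} {S T : Finset (Fin n × Bool)} (h : S ⊆ T) :
    P v T ⊆ P v S := fun _ hx => ⟨hx.1, hx.2.1, hx.2.2.1, fun e he => hx.2.2.2 e (h he)⟩

lemma Free.notMem {n : ℕ} {S : Finset (Fin n × Bool)} {e : Fin n × Bool} (h : Free S e.1) :
    e ∉ S := h e.2

lemma val_inj {a b : Bool} (h : val a = val b) : a = b := by
  cases a <;> cases b <;> simp_all [val]

/-- complete faces: vertices -/
def V {n m : ℕ} (v : Fin n → Fin m → ℝ) (S : Finset (Fin n × Bool)) : Prop :=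
  (P v S).Nonempty ∧ S.card + m = n

lemma exists_V {n m : ℕ} (v : Fin n → Fin m → ℝ) : ∀ (k : ℕ) (S : Finset (Fin n × Bool)),
    S.card + m + k = n → (P v S).Nonempty → ∃ T, S ⊆ T ∧ V v T := by
  intro k
  induction k with
  | zero => exact fun S hS hP => ⟨S, subset_rfl, hP, hS⟩
  | succ k ih =>
    intro S hS hP
    obtain ⟨x, hx, e, he, hxe⟩ := D_nonempty v S (by omega) hP
    obtain ⟨T, hT, hV⟩ := ih (insert e S)
      (by rw [Finset.card_insert_of_notMem he.notMem]; omega) ⟨x, P_insert.2 ⟨hx, hxe⟩⟩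
    exact ⟨T, (Finset.subset_insert _ _).trans hT, hV⟩

/-- number of cookies of the first child -/
def a {n : ℕ} (S : Finset (Fin n × Bool)) : ℕ := (S.filter fun e => e.2 = true).card

lemma a_mono {n : ℕ} {S T : Finset (Fin n × Bool)} (h : S ⊆ T) : a S ≤ a T :=
  Finset.card_le_card (Finset.filter_subset_filter _ h)

lemma a_le {n : ℕ} {S T : Finset (Fin n × Bool)} (h : S ⊆ T) : a T + S.card ≤ a S + T.card := by
  have h1 := Finset.card_filter_add_card_filter_not (s := S) (fun e => e.2 = true)
  have h2 := Finset.card_filter_add_card_filter_not (s := T) (fun e => e.2 = true)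
  have h3 := Finset.card_le_card (Finset.filter_subset_filter (fun e => ¬ e.2 = true) h)
  unfold a
  omega

/-- more for the first child -/
def Pos {n : ℕ} (S : Finset (Fin n × Bool)) : Prop := S.card < 2 * a S

/-- balanced vertex -/
def Bal {n : ℕ} (S : Finset (Fin n × Bool)) : Prop := 2 * a S ≤ S.card + 1 ∧ S.card ≤ 2 * a S + 1

lemma same_sign {n m : ℕ} (v : Fin n → Fin m → ℝ) (hB : ∀ T, V v T → ¬ Bal T) :
    ∀ (k : ℕ) (S : Finset (Fin n × Bool)), S.card + m + k = n →
    ∀ T T', S ⊆ T → S ⊆ T' → V v T → V v T' → Pos T → Pos T' := by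
  intro k
  induction k with
  | zero =>
    intro S hS T T' hT hT' hV hV' hp
    have h1 := Finset.eq_of_subset_of_card_le hT (by have := hV.2; omega)
    have h2 := Finset.eq_of_subset_of_card_le hT' (by have := hV'.2; omega)
    rw [← h2, h1]; exact hp
  | succ k ih =>
    intro S hS T T' hT hT' hV hV' hp
    rcases Nat.eq_zero_or_pos k with rfl | hk
    · have := a_mono hT
      have := a_mono hT'
      have := a_le hT
      have := a_le hT'
      have := hV.2
      have := hV'.2
      have := hB T hV
      have := hB T' hV'
      unfold Bal Pos at *
      omega
    · -- the boundary is connected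
      have hconn := D_preconnected v S (by omega)
      let E := {e : Fin n × Bool // Free S e.1}
      let Q : E → Set (Fin n → ℝ) := fun e => {x | x e.1.1 = val e.1.2}
      let c : E → Prop := fun e => ∀ T, insert e.1 S ⊆ T → V v T → Pos T
      have hcard : ∀ e : E, (insert e.1 S).card + m + k = n := fun e => by
        rw [Finset.card_insert_of_notMem e.2.notMem]; omega
      have hex : ∀ T, S ⊆ T → V v T → ∃ e : E, insert e.1 S ⊆ T ∧ (D v S ∩ Q e).Nonempty := by
        intro T hT hV
        obtain ⟨⟨x, hx⟩, hc⟩ := hV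
        obtain ⟨e, he, heS⟩ := Finset.exists_of_ssubset
          (Finset.ssubset_iff_subset_ne.2 ⟨hT, fun h => by rw [← h] at hc; omega⟩)
        have hf : Free S e.1 := by
          intro b hb
          have h1 := hx.2.2.2 _ he
          have h2 := hx.2.2.2 _ (hT hb)
          have : b = e.2 := val_inj (h2.symm.trans h1)
          subst this
          exact heS hb
        exact ⟨⟨e, hf⟩, Finset.insert_subset he hT, x,
          ⟨P_mono hT hx, e, hf, hx.2.2.2 _ he⟩, hx.2.2.2 _ he⟩
      obtain ⟨e, heT, heD⟩ := hex T hT hV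
      obtain ⟨e', heT', heD'⟩ := hex T' hT' hV'
      refine color (D v S) hconn Q (fun e => ?_) ?_ c ?_ e e' heD heD' ?_ T' heT' hV'
      · exact isClosed_eq (continuous_apply _) continuous_const
      · rintro x ⟨-, e, he, hxe⟩
        exact Set.mem_iUnion.2 ⟨⟨e, he⟩, hxe⟩
      · rintro e e' ⟨x, hxD, hxe, hxe'⟩ hce U hU hVU
        by_cases hee : e = e'
        · subst hee; exact hce U hU hVU
        have hne : e'.1 ∉ insert e.1 S := by
          rw [Finset.mem_insert, not_or]
          exact ⟨fun h => hee (Subtype.ext h.symm), e'.2.notMem⟩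
        obtain ⟨W, hW, hVW⟩ := exists_V v (k - 1) (insert e'.1 (insert e.1 S))
          (by rw [Finset.card_insert_of_notMem hne]; have := hcard e; omega)
          ⟨x, P_insert.2 ⟨P_insert.2 ⟨hxD.1, hxe⟩, hxe'⟩⟩
        have hpW := hce W ((Finset.subset_insert _ _).trans hW) hVW
        refine ih _ (hcard e') W U (Finset.Subset.trans ?_ hW) hU hVW hVU hpW
        exact Finset.insert_subset_insert _ (Finset.subset_insert _ _)
      · intro U hU hVU
        exact ih _ (hcard e) T U heT hU hV hVU hp

lemma exists_Bal {n m : ℕ} (v : Fin n → Fin m → ℝ) (h : m ≤ n) : ∃ T, V v T ∧ Bal T := by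
  by_contra! hB
  obtain ⟨T, -, hT⟩ := exists_V v (n - m) ∅ (by simp; omega)
    ⟨fun _ => 1 / 2, fun _ => by norm_num, fun _ => by norm_num, fun k => by
      rw [← Finset.mul_sum]; ring, by simp⟩
  have hinj : Function.Injective (fun e : Fin n × Bool => (e.1, !e.2)) := by
    rintro ⟨i, b⟩ ⟨j, c⟩ h
    simpa using h
  let T' := T.image (fun e : Fin n × Bool => (e.1, !e.2))
  have hc : T'.card = T.card := Finset.card_image_of_injective _ hinj
  have ha : a T' + a T = T.card := by
    have h1 := Finset.card_filter_add_card_filter_not (s := T) (fun e => e.2 = true)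
    have : a T' = (T.filter fun e => ¬ e.2 = true).card := by
      unfold a
      simp only [T', Finset.filter_image]
      rw [Finset.card_image_of_injective _ hinj]
      simp
    rw [this, ← h1, add_comm]; rfl
  have hT' : V v T' := by
    obtain ⟨⟨x, x0, x1, xs, xS⟩, hcc⟩ := hT
    refine ⟨⟨fun i => 1 - x i, fun i => by linarith [x1 i], fun i => by linarith [x0 i], ?_, ?_⟩,
      by omega⟩
    · intro k
      simp only [sub_mul, Finset.sum_sub_distrib, xs k, one_mul]
      ring
    · intro e he
      obtain ⟨⟨i, b⟩, hf, rfl⟩ := Finset.mem_image.1 he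
      have := xS _ hf
      cases b <;> simp_all [val]
  have h1 := same_sign v hB (n - m) ∅ (by simp; omega) T T' (by simp) (by simp) hT hT'
  have h2 := same_sign v hB (n - m) ∅ (by simp; omega) T' T (by simp) (by simp) hT' hT
  have h3 := hB T hT
  unfold Pos at h1 h2
  unfold Bal at h3
  omega

end Cookie



/-- Two-child cookie splitting: `n` cookies with `m` kinds of frosting can be split between two
children cutting at most `m` cookies, so that each child receives exactly half of each frosting
kind and at least `⌊(n-m)/2⌋` whole cookies. -/
theorem two_children_cookie_splitting (n m : ℕ) (hn : 0 < n) (hm : 0 < m)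
    (v : Fin n → Fin m → ℝ) (hv : ∀ i j, 0 ≤ v i j) :
    ∃ (w : Fin n → Fin 2 → Fin m → ℝ) (C : Finset (Fin n)) (owner : Fin n → Fin 2),
      (∀ i j k, 0 ≤ w i j k) ∧
      (∀ i, ∑ j : Fin 2, w i j = v i) ∧
      (∀ i ∉ C, ∀ j, w i j = if j = owner i then v i else 0) ∧
      C.card ≤ m ∧
      (∀ j : Fin 2, (2 : ℝ) • ∑ i, w i j = ∑ i, v i) ∧
      (∀ j : Fin 2,
        ⌊(((n : ℚ) - m) / 2)⌋
          ≤ ((Finset.univ.filter fun i => i ∉ C ∧ owner i = j).card : ℤ)) := by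
  rcases lt_or_ge n m with hlt | hge
  · refine ⟨fun i _ => (1 / 2 : ℝ) • v i, Finset.univ, fun _ => 0, ?_, ?_, ?_, ?_, ?_, ?_⟩
    · intro i j k
      have := hv i k
      simp; linarith
    · intro i
      ext k
      simp
    · simp
    · simpa using hlt.le
    · intro j
      rw [← Finset.smul_sum, smul_smul]
      norm_num
    · intro j
      have hq : (n : ℚ) < m := by exact_mod_cast hlt
      have : ⌊((n : ℚ) - m) / 2⌋ < 0 := Int.floor_lt.2 (by push_cast; linarith)
      have h2 : (0 : ℤ) ≤ ((Finset.univ.filter fun i : Fin n =>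
        i ∉ (Finset.univ : Finset (Fin n)) ∧ (0 : Fin 2) = j).card : ℤ) := by positivity
      exact this.le.trans h2
  obtain ⟨T, ⟨⟨x, x0, x1, xs, xS⟩, hcard⟩, hbal⟩ := Cookie.exists_Bal v hge
  have hinj : Set.InjOn (Prod.fst : Fin n × Bool → Fin n) (T : Set (Fin n × Bool)) := by
    rintro ⟨i, b⟩ he ⟨i', b'⟩ he' h
    have h1 := xS _ he
    have h2 := xS _ he'
    simp only at h h1 h2
    subst h
    rw [Cookie.val_inj (h1.symm.trans h2)]
  have hfst : (T.image Prod.fst).card = T.card := Finset.card_image_of_injOn hinj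
  refine ⟨fun i j => if j = 0 then x i • v i else (1 - x i) • v i, (T.image Prod.fst)ᶜ,
    fun i => if (i, true) ∈ T then 0 else 1, ?_, ?_, ?_, ?_, ?_, ?_⟩
  · intro i j k
    dsimp only
    split_ifs
    · exact mul_nonneg (x0 i) (hv i k)
    · exact mul_nonneg (by linarith [x1 i]) (hv i k)
  · intro i
    ext k
    simp [Fin.sum_univ_two]
    ring
  · intro i hi j
    simp only [Finset.mem_compl, not_not, Finset.mem_image] at hi
    obtain ⟨⟨i', b⟩, he, rfl⟩ := hi
    have h1 := xS _ he
    cases b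
    · have h2 : (i', true) ∉ T := fun h => by
        have := xS _ h
        simp only [Cookie.val] at this h1
        simp [this] at h1
      simp only [Cookie.val] at h1
      fin_cases j <;> simp [h1, h2]
    · simp only [Cookie.val] at h1
      fin_cases j <;> simp [h1, he]
  · rw [Finset.card_compl, hfst, Fintype.card_fin]
    omega
  · intro j
    ext k
    have := xs k
    fin_cases j
    · simp [this]
      ring
    · simp [sub_mul, this]
      ring
  · intro j
    have hA := Finset.card_filter_add_card_filter_not (s := T) (fun e => e.2 = true)
    have hfl : ⌊((n : ℚ) - m) / 2⌋ = (T.card : ℤ) / 2 := by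
      have : ((n : ℚ) - m) = ((T.card : ℤ) : ℚ) := by
        have : (n : ℚ) = T.card + m := by exact_mod_cast hcard.symm
        rw [this]; push_cast; ring
      rw [this]
      exact_mod_cast Rat.floor_intCast_div_natCast (T.card : ℤ) 2
    rw [hfl]
    unfold Cookie.Bal at hbal
    have ha : Cookie.a T = (T.filter fun e => e.2 = true).card := rfl
    fin_cases j
    · have : (T.filter fun e => e.2 = true).card ≤ (Finset.univ.filter fun i =>
          i ∉ (T.image Prod.fst)ᶜ ∧ (if (i, true) ∈ T then (0 : Fin 2) else 1) = 0).card := by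
        refine Finset.card_le_card_of_injOn Prod.fst ?_
          (hinj.mono (Finset.coe_subset.2 (Finset.filter_subset _ _)))
        rintro ⟨i, b⟩ he
        simp only [Finset.coe_filter, Set.mem_ofPred_eq] at he
        obtain ⟨he, rfl⟩ := he
        simp only [Finset.coe_filter, Set.mem_ofPred_eq]
        refine ⟨Finset.mem_univ _, ?_, by simp [he]⟩
        rw [Finset.mem_compl, not_not]
        exact Finset.mem_image_of_mem _ he
      refine le_trans ?_ (Int.ofNat_le.2 this)
      omega
    · have : (T.filter fun e => ¬ e.2 = true).card ≤ (Finset.univ.filter fun i =>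
          i ∉ (T.image Prod.fst)ᶜ ∧ (if (i, true) ∈ T then (0 : Fin 2) else 1) = 1).card := by
        refine Finset.card_le_card_of_injOn Prod.fst ?_
          (hinj.mono (Finset.coe_subset.2 (Finset.filter_subset _ _)))
        rintro ⟨i, b⟩ he
        simp only [Finset.coe_filter, Set.mem_ofPred_eq, Bool.not_eq_true] at he
        obtain ⟨he, rfl⟩ := he
        have h2 : (i, true) ∉ T := fun h => by
          have := hinj he h rfl
          simp at this
        simp only [Finset.coe_filter, Set.mem_ofPred_eq]
        refine ⟨Finset.mem_univ _, ?_, by simp [h2]⟩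
        rw [Finset.mem_compl, not_not]
        exact Finset.mem_image_of_mem _ he
      refine le_trans ?_ (Int.ofNat_le.2 this)
      omega
end

section
/- Let r, n, m be positive integers. Given n cookies, each an m-tuple of nonnegative reals (divisible frosting amounts), there exists a distribution among r children cutting at most (r−1)m cookies (a cut cookie's vector is split as a sum of nonnegative vectors given to possibly different children) such that every child receives exactly 1/r of the total of each frosting kind, and each child receives at least ⌊(n − ⌈m(r−1)/2⌉)/r⌋ − ⌊m(r−1)/2⌋ whole cookies. -/
namespace Cookie
open Finset

variable {ι κ : Type} [Fintype ι] [Fintype κ]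

def Wh (t : ℝ) : Prop := t = 0 ∨ t = 1

def Box (y : ι → ℝ) : Prop := ∀ i, 0 ≤ y i ∧ y i ≤ 1

def Vert (V : ι → κ → ℝ) (y : ι → ℝ) : Prop :=
  ∀ e : ι → ℝ, (∀ i, Wh (y i) → e i = 0) → ∑ i, e i • V i = 0 → e = 0

lemma card_le_of_ker (V : ι → κ → ℝ) (K : Finset ι)
    (h : ∀ e : ι → ℝ, (∀ i, i ∉ K → e i = 0) → ∑ i, e i • V i = 0 → e = 0) :
    K.card ≤ Fintype.card κ := by
  classical
  have hl : LinearIndependent ℝ (fun i : K => V i) := by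
    rw [Fintype.linearIndependent_iff]
    intro g hg i
    have := h (fun i => if hi : i ∈ K then g ⟨i, hi⟩ else 0) (by intro i hi; simp [hi]) (by
      rw [← hg, ← Finset.sum_subset (Finset.subset_univ K)]
      · rw [← Finset.sum_attach]
        apply Finset.sum_congr rfl
        intro i _
        simp
      · intro i _ hi; simp [hi])
    have := congrFun this i
    simpa using this
  have := hl.fintype_card_le_finrank
  simpa using this

lemma move (x e : ι → ℝ) (hx : Box x) (he : e ≠ 0)
    (h0 : ∀ i, x i = 0 → 0 ≤ e i) (h1 : ∀ i, x i = 1 → e i ≤ 0) :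
    ∃ t : ℝ, 0 < t ∧ Box (fun i => x i + t * e i) ∧ ∃ i, e i ≠ 0 ∧ Wh (x i + t * e i) := by
  classical
  obtain ⟨k, hk⟩ : ∃ k, e k ≠ 0 := by
    by_contra hcon; push Not at hcon; exact he (funext hcon)
  let ρ : ι → ℝ := fun i => if 0 < e i then (1 - x i) / e i else x i / (- e i)
  have hρ : ∀ i, e i ≠ 0 → 0 < ρ i := by
    intro i hi
    simp only [ρ]
    split_ifs with hp
    · apply div_pos _ hp
      rcases lt_or_eq_of_le (hx i).2 with h | h
      · linarith
      · linarith [h1 i h]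
    · have hn : e i < 0 := lt_of_le_of_ne (not_lt.mp hp) hi
      apply div_pos _ (by linarith)
      rcases lt_or_eq_of_le (hx i).1 with h | h
      · linarith
      · linarith [h0 i h.symm]
  obtain ⟨i0, hi0, hmin⟩ := Finset.exists_min_image (univ.filter fun i => e i ≠ 0) ρ
    ⟨k, by simp [hk]⟩
  have hi0' : e i0 ≠ 0 := by simpa using hi0
  refine ⟨ρ i0, hρ _ hi0', ?_, i0, hi0', ?_⟩
  · intro i
    have hp := hρ _ hi0'
    by_cases hi : e i = 0
    · simpa [hi] using hx i
    · have hm := hmin i (by simp [hi])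
      have hxi := hx i
      rcases lt_or_gt_of_ne hi with hn | hpos
      · have e1 : ρ i = x i / (- e i) := by simp only [ρ]; rw [if_neg (by linarith)]
        rw [e1, le_div_iff₀ (by linarith)] at hm
        constructor <;> nlinarith
      · have e1 : ρ i = (1 - x i) / e i := by simp only [ρ]; rw [if_pos hpos]
        rw [e1, le_div_iff₀ hpos] at hm
        constructor <;> nlinarith
  · rcases lt_or_gt_of_ne hi0' with hn | hpos
    · left
      have e1 : ρ i0 = x i0 / (- e i0) := by simp only [ρ]; rw [if_neg (by linarith)]
      rw [e1]; field_simp; ring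
    · right
      have e1 : ρ i0 = (1 - x i0) / e i0 := by simp only [ρ]; rw [if_pos hpos]
      rw [e1]; field_simp; ring

lemma reduce (V : ι → κ → ℝ) (x : ι → ℝ) (hx : Box x) :
    ∃ y : ι → ℝ, Box y ∧ ∑ i, y i • V i = ∑ i, x i • V i ∧
      (∀ i, x i = 0 → y i = 0) ∧ (∀ i, x i = 1 → y i = 1) ∧ Vert V y := by
  classical
  induction hN : (univ.filter fun i => ¬ Wh (x i)).card using Nat.strong_induction_on
    generalizing x with
  | _ N ih =>
  by_cases hv : Vert V x
  · exact ⟨x, hx, rfl, fun _ h => h, fun _ h => h, hv⟩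
  · unfold Vert at hv
    push Not at hv
    obtain ⟨e, he1, he2, he3⟩ := hv
    obtain ⟨t, ht, hb, i0, hi0, hw⟩ := move x e hx he3
      (fun i hi => (he1 i (Or.inl hi)).ge) (fun i hi => (he1 i (Or.inr hi)).le)
    have hlt : (univ.filter fun i => ¬ Wh (x i + t * e i)).card < N := by
      rw [← hN]
      apply Finset.card_lt_card
      rw [Finset.ssubset_iff_of_subset]
      · exact ⟨i0, by simpa using fun h => hi0 (he1 _ h), by simpa using hw⟩
      · intro i
        simp only [mem_filter, mem_univ, true_and]
        intro h hh
        rw [he1 i hh] at h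
        simp at h; exact h hh
    obtain ⟨y, hy1, hy2, hy3, hy4, hy5⟩ := ih _ hlt (fun i => x i + t * e i) hb rfl
    refine ⟨y, hy1, ?_, ?_, ?_, hy5⟩
    · rw [hy2]
      simp only [add_smul, mul_smul, Finset.sum_add_distrib, ← Finset.smul_sum, he2]
      simp
    · intro i hi; apply hy3; simp [he1 i (Or.inl hi), hi]
    · intro i hi; apply hy4; simp [he1 i (Or.inr hi), hi]

lemma Vert.card_le {V : ι → κ → ℝ} {y : ι → ℝ} (h : Vert V y) (K : Finset ι)
    (hK : ∀ i ∈ K, ¬ Wh (y i)) :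
    K.card ≤ Fintype.card κ := by
  apply card_le_of_ker V
  intro e he
  apply h e
  intro i hi
  apply he
  exact fun h => hK i h hi

lemma edge (V : ι → κ → ℝ) (g p d : ι → ℝ) (hp : Vert V p)
    (h0 : ∀ i, p i = 0 → 0 ≤ d i) (h1 : ∀ i, p i = 1 → d i ≤ 0)
    (hd : ∑ i, d i • V i = 0) (hg : 0 < ∑ i, d i * g i) :
    ∃ d' : ι → ℝ, (∀ i, p i = 0 → 0 ≤ d' i) ∧ (∀ i, p i = 1 → d' i ≤ 0) ∧
      ∑ i, d' i • V i = 0 ∧ 0 < ∑ i, d' i * g i ∧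
      ∀ e : ι → ℝ, (∀ i, Wh (p i) → d' i = 0 → e i = 0) → ∑ i, e i • V i = 0 →
        ∑ i, e i * g i = 0 → e = 0 := by
  classical
  induction hN : (univ.filter fun i => Wh (p i) ∧ d i ≠ 0).card using Nat.strong_induction_on
    generalizing d with
  | _ N ih =>
  by_cases hv : ∀ e : ι → ℝ, (∀ i, Wh (p i) → d i = 0 → e i = 0) → ∑ i, e i • V i = 0 →
        ∑ i, e i * g i = 0 → e = 0
  · exact ⟨d, h0, h1, hd, hg, hv⟩
  push Not at hv
  obtain ⟨e, he1, he2, he3, he4⟩ := hv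
  obtain ⟨k, hk1, hk2⟩ : ∃ i, Wh (p i) ∧ e i ≠ 0 := by
    by_contra hcon
    push Not at hcon
    exact he4 (hp e hcon he2)
  obtain ⟨i0, hi0, hmin⟩ := Finset.exists_min_image (univ.filter fun i => Wh (p i) ∧ e i ≠ 0)
    (fun i => |d i / e i|) ⟨k, by simp [hk1, hk2]⟩
  simp only [mem_filter, mem_univ, true_and] at hi0 hmin
  set t := d i0 / e i0 with ht
  have habs : ∀ i, Wh (p i) → |t * e i| ≤ |d i| := by
    intro i hi
    by_cases hz : e i = 0
    · simp [hz]
    · have := hmin i ⟨hi, hz⟩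
      rw [abs_div (d i), le_div_iff₀ (abs_pos.mpr hz)] at this
      rwa [abs_mul]
  refine ih _ ?_ (fun i => d i - t * e i) ?_ ?_ ?_ ?_ rfl
  · rw [← hN]
    apply Finset.card_lt_card
    rw [Finset.ssubset_iff_of_subset]
    · refine ⟨i0, ?_, ?_⟩
      · simp only [mem_filter, mem_univ, true_and]
        exact ⟨hi0.1, fun h => hi0.2 (he1 _ hi0.1 h)⟩
      · simp only [mem_filter, mem_univ, true_and, not_and, not_not]
        intro _
        rw [ht]; field_simp [hi0.2]; ring
    · intro i
      simp only [mem_filter, mem_univ, true_and]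
      rintro ⟨ha, hb⟩
      refine ⟨ha, fun h => hb ?_⟩
      rw [he1 i ha h, h]; simp
  · intro i hi
    have a := habs i (Or.inl hi)
    rw [abs_of_nonneg (h0 i hi)] at a
    have := (abs_le.mp a).2
    show 0 ≤ d i - t * e i
    linarith
  · intro i hi
    have a := habs i (Or.inr hi)
    rw [abs_of_nonpos (h1 i hi)] at a
    have := (abs_le.mp a).1
    show d i - t * e i ≤ 0
    linarith
  · simp only [sub_smul, mul_smul, Finset.sum_sub_distrib, ← Finset.smul_sum, he2, hd]
    simp
  · simp only [sub_mul, mul_assoc, Finset.sum_sub_distrib, ← Finset.mul_sum, he3]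
    simpa using hg

/-- unbalanced split -/
lemma split_unbal (V : ι → κ → ℝ) (S : Finset ι) (α : ℝ) (ha0 : 0 ≤ α) (ha1 : α ≤ 1) :
    ∃ y : ι → ℝ, Box y ∧ ∑ i, y i • V i = α • ∑ i, V i ∧
      (∀ K : Finset ι, (∀ i ∈ K, ¬ Wh (y i)) → K.card ≤ Fintype.card κ) ∧
      ∀ T1 T0 : Finset ι, (∀ i ∈ S, y i = 1 → i ∈ T1) → (∀ i ∈ S, y i = 0 → i ∈ T0) →
      α * S.card < T1.card + Fintype.card κ + 1 ∧
      (1 - α) * S.card < T0.card + Fintype.card κ + 1 := by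
  classical
  let V' : ι → Option κ → ℝ := fun i o => o.elim (if i ∈ S then 1 else 0) (V i)
  obtain ⟨z, hz1, hz2, -, -, hz5⟩ := reduce V' (fun _ => α) (fun _ => ⟨ha0, ha1⟩)
  obtain ⟨y, hy1, hy2, hy3, hy4, hy5⟩ := reduce V z hz1
  have hV : ∑ i, z i • V i = α • ∑ i, V i := by
    ext k
    have := congrFun hz2 (some k)
    simpa [V', Finset.mul_sum] using this
  have hS : ∑ i ∈ S, z i = α * S.card := by
    have := congrFun hz2 none
    simp [V'] at this
    rw [this]; ring
  refine ⟨y, hy1, hy2.trans hV, fun K hK => hy5.card_le K hK, ?_⟩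
  intro T1 T0 hT1 hT0
  let F := S.filter fun i => ¬ Wh (z i)
  have hF : F.card ≤ Fintype.card κ + 1 := by
    have := hz5.card_le F (by intro i hi; exact (mem_filter.mp hi).2)
    simpa using this
  have hF' : (F.card : ℝ) ≤ Fintype.card κ + 1 := by exact_mod_cast hF
  have key : ∀ (f : ι → ℝ) (T : Finset ι), (∀ i ∈ S, Wh (z i) → f i = if i ∈ T then 1 else 0) →
      (∀ i ∈ F, f i < 1) → ∑ i ∈ S, f i < T.card + Fintype.card κ + 1 := by
    intro f T hf hlt
    rw [← Finset.sum_filter_add_sum_filter_not S (fun i => Wh (z i)) f]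
    have e1 : ∑ i ∈ S with Wh (z i), f i ≤ T.card := by
      rw [Finset.sum_congr rfl (g := fun i => if i ∈ T then (1:ℝ) else 0)]
      · rw [← Finset.sum_filter, Finset.sum_const, nsmul_eq_mul, mul_one]
        exact_mod_cast Finset.card_le_card (by intro i hi; exact (mem_filter.mp hi).2)
      · intro i hi
        exact hf i (mem_filter.mp hi).1 (mem_filter.mp hi).2
    have e2 : ∑ i ∈ F, f i < Fintype.card κ + 1 := by
      rcases F.eq_empty_or_nonempty with h | h
      · rw [h]; simp; positivity
      · calc ∑ i ∈ F, f i < ∑ i ∈ F, (1:ℝ) := Finset.sum_lt_sum_of_nonempty h hlt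
          _ = F.card := by simp
          _ ≤ _ := hF'
    have : ∑ i ∈ S with ¬ Wh (z i), f i = ∑ i ∈ F, f i := rfl
    linarith
  have hle1 : ((S.filter fun i => z i = 1).card : ℝ) ≤ T1.card := by
    exact_mod_cast Finset.card_le_card (by
      intro i hi; rw [mem_filter] at hi; exact hT1 i hi.1 (hy4 i hi.2))
  have hle0 : ((S.filter fun i => z i = 0).card : ℝ) ≤ T0.card := by
    exact_mod_cast Finset.card_le_card (by
      intro i hi; rw [mem_filter] at hi; exact hT0 i hi.1 (hy3 i hi.2))
  constructor
  · have := key z (S.filter fun i => z i = 1) (by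
      intro i hi hw
      rcases hw with h | h <;> simp [h, hi]) (by
      intro i hi
      have := (mem_filter.mp hi).2
      exact lt_of_le_of_ne (hz1 i).2 fun h => this (Or.inr h))
    rw [hS] at this
    linarith
  · have := key (fun i => 1 - z i) (S.filter fun i => z i = 0) (by
      intro i hi hw
      rcases hw with h | h <;> simp [h, hi]) (by
      intro i hi
      have := (mem_filter.mp hi).2
      have := lt_of_le_of_ne (hz1 i).1 fun h => this (Or.inl h.symm)
      linarith)
    rw [Finset.sum_sub_distrib, hS] at this
    simp at this
    linarith

noncomputable def cnt (S : Finset ι) (y : ι → ℝ) (c : ℝ) : ℕ := (S.filter fun i => y i = c).card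

lemma cnt_compl (S : Finset ι) (y : ι → ℝ) : cnt S (fun i => 1 - y i) 1 = cnt S y 0 ∧
    cnt S (fun i => 1 - y i) 0 = cnt S y 1 := by
  unfold cnt
  constructor
  · congr 1; ext i; simp
  · congr 1; ext i; simp only [mem_filter]; constructor
    · rintro ⟨a, b⟩; exact ⟨a, by linarith⟩
    · rintro ⟨a, b⟩; exact ⟨a, by linarith⟩

def IsV (V : ι → κ → ℝ) (y : ι → ℝ) : Prop :=
  Box y ∧ ∑ i, y i • V i = (1/2 : ℝ) • ∑ i, V i ∧ Vert V y

lemma vert_ext {V : ι → κ → ℝ} {y z : ι → ℝ} (hy : IsV V y)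
    (hz : ∑ i, z i • V i = (1/2 : ℝ) • ∑ i, V i)
    (h : ∀ i, Wh (y i) → z i = y i) : z = y := by
  have := hy.2.2 (z - y) (by intro i hi; simp [h i hi]) (by
    simp only [Pi.sub_apply, sub_smul, Finset.sum_sub_distrib]
    rw [hz, hy.2.1, sub_self])
  exact sub_eq_zero.mp this

lemma finite_V (V : ι → κ → ℝ) : {y | IsV V y}.Finite := by
  classical
  apply Set.Finite.of_injOn (f := fun (y : ι → ℝ) (i : ι) => ((decide (y i = 0), decide (y i = 1)) : Bool × Bool))
    (t := Set.univ) (fun _ _ => Set.mem_univ _) _ Set.finite_univ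
  intro y hy z hz h
  apply (vert_ext hy hz.2.1 _).symm
  intro i hi
  have := congrFun h i
  simp only [Prod.mk.injEq, decide_eq_decide] at this
  rcases hi with hi | hi
  · rw [hi, this.1.mp hi]
  · rw [hi, this.2.mp hi]

lemma compl_V {V : ι → κ → ℝ} {y : ι → ℝ} (hy : IsV V y) : IsV V (fun i => 1 - y i) := by
  refine ⟨fun i => ⟨by linarith [(hy.1 i).2], by linarith [(hy.1 i).1]⟩, ?_, ?_⟩
  · simp only [sub_smul, Finset.sum_sub_distrib, hy.2.1, one_smul]
    module
  · intro e he
    apply hy.2.2 e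
    intro i hi
    apply he
    rcases hi with h | h <;> simp [h, Wh]

lemma cnt_add (V : ι → κ → ℝ) (S : Finset ι) (y : ι → ℝ) (hy : Vert V y) :
    S.card ≤ cnt S y 1 + cnt S y 0 + Fintype.card κ := by
  classical
  have h := hy.card_le (S.filter fun i => ¬ Wh (y i)) (by intro i hi; exact (mem_filter.mp hi).2)
  have : S ⊆ (S.filter fun i => y i = 1) ∪ (S.filter fun i => y i = 0) ∪
      (S.filter fun i => ¬ Wh (y i)) := by
    intro i hi
    simp only [mem_union, mem_filter, hi, true_and]
    unfold Wh
    tauto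
  have h2 := (card_le_card this).trans (card_union_le _ _)
  have h3 := card_union_le (S.filter fun i => y i = 1) (S.filter fun i => y i = 0)
  unfold cnt
  omega

lemma split_bal (V : ι → κ → ℝ) (S : Finset ι) (h : ℤ)
    (hh : 2 * h + Fintype.card κ ≤ S.card) :
    ∃ y : ι → ℝ, IsV V y ∧ h ≤ cnt S y 1 ∧ h ≤ cnt S y 0 := by
  classical
  by_contra hcon
  push Not at hcon
  -- one `neg` vertex and one `pos` vertex
  obtain ⟨p0, a1, a2, -, -, a5⟩ := reduce V (fun _ => (1/2 : ℝ))
    (fun _ => by constructor <;> norm_num)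
  have hp0 : IsV V p0 := ⟨a1, by rw [a2, Finset.smul_sum], a5⟩
  have hexcl : ∀ y, IsV V y → (cnt S y 1 : ℤ) < h → (cnt S y 0 : ℤ) < h → False := by
    intro y hy h1 h2
    have := cnt_add V S y hy.2.2
    omega
  obtain ⟨p, hp, hpn⟩ : ∃ p, IsV V p ∧ (cnt S p 1 : ℤ) < h := by
    by_cases hc : (cnt S p0 1 : ℤ) < h
    · exact ⟨p0, hp0, hc⟩
    · refine ⟨_, compl_V hp0, ?_⟩
      rw [(cnt_compl S p0).1]
      exact hcon _ hp0 (not_lt.mp hc)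
  have hpos : {y | IsV V y ∧ (cnt S y 0 : ℤ) < h}.Nonempty :=
    ⟨_, compl_V hp, by rw [(cnt_compl S p).2]; exact hpn⟩
  have hfin : {y | IsV V y ∧ (cnt S y 0 : ℤ) < h}.Finite :=
    (finite_V V).subset (fun y hy => hy.1)
  let g : ι → ℝ := fun i => if p i = 1 then 1 else if p i = 0 then -1 else 0
  obtain ⟨q, ⟨hq, hqn⟩, hqmax⟩ := Set.exists_max_image _ (fun y : ι → ℝ => ∑ i, y i * g i) hfin hpos
  have hterm : ∀ i, q i * g i ≤ p i * g i := by
    intro i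
    simp only [g]
    split_ifs with c1 c2
    · rw [c1]; linarith [(hq.1 i).2]
    · rw [c2]; linarith [(hq.1 i).1]
    · simp
  have hlt : ∑ i, q i * g i < ∑ i, p i * g i := by
    apply lt_of_le_of_ne (Finset.sum_le_sum fun i _ => hterm i)
    intro heq
    rw [Finset.sum_eq_sum_iff_of_le (fun i _ => hterm i)] at heq
    have : q = p := by
      apply vert_ext hp hq.2.1
      intro i hi
      have := heq i (mem_univ _)
      rcases hi with c | c <;> simp [g, c] at this <;> rw [c, this]
    rw [this] at hqn
    exact hexcl p hp hpn hqn
  obtain ⟨d, d0, d1, dV, dg, dk⟩ := edge V g q (fun i => p i - q i) hq.2.2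
    (fun i hi => by simp only [hi]; linarith [(hp.1 i).1])
    (fun i hi => by simp only [hi]; linarith [(hp.1 i).2])
    (by simp only [sub_smul, Finset.sum_sub_distrib, hp.2.1, hq.2.1, sub_self])
    (by simp only [sub_mul, Finset.sum_sub_distrib]; linarith)
  have hd0 : d ≠ 0 := by rintro rfl; simp at dg
  obtain ⟨t, ht, hb, i0, hi0, hw⟩ := move q d hq.1 hd0 d0 d1
  have hz : IsV V (fun i => q i + t * d i) := by
    refine ⟨hb, ?_, ?_⟩
    · simp only [add_smul, mul_smul, Finset.sum_add_distrib, ← Finset.smul_sum, dV, hq.2.1]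
      simp
    · intro e he heV
      have := dk (fun i => e i - ((∑ i, e i * g i) / (∑ i, d i * g i)) * d i) (by
          intro i hi hdi
          simp only [hdi, mul_zero, sub_zero]
          apply he
          simpa [hdi] using hi) (by
          simp only [sub_smul, mul_smul, Finset.sum_sub_distrib, ← Finset.smul_sum, dV, heV]
          simp) (by
          simp only [sub_mul, mul_assoc, Finset.sum_sub_distrib, ← Finset.mul_sum]
          field_simp
          ring)
      have h0 := congrFun this i0
      simp only [he i0 hw, zero_sub, Pi.zero_apply, neg_eq_zero, mul_eq_zero, hi0, or_false] at h0
      rw [h0] at this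
      simpa using this
  have hzn : (cnt S (fun i => q i + t * d i) 1 : ℤ) < h := by
    by_contra hc
    have hz0 := hcon _ hz (not_lt.mp hc)
    have := hqmax _ ⟨hz, hz0⟩
    simp only [add_mul, mul_assoc, Finset.sum_add_distrib, ← Finset.mul_sum] at this
    have := mul_pos ht dg
    linarith
  -- count
  have hK : (univ.filter fun i => ¬ (Wh (q i) ∧ d i = 0)).card ≤ Fintype.card κ + 1 := by
    have := card_le_of_ker (κ := Option κ) (fun i o => o.elim (g i) (V i))
      (univ.filter fun i => ¬ (Wh (q i) ∧ d i = 0)) (by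
        intro e he hs
        apply dk e
        · intro i a b
          apply he
          simp [a, b]
        · ext k
          simpa using congrFun hs (some k)
        · simpa using congrFun hs none)
    simpa using this
  have hsub : S ⊆ (univ.filter fun i => ¬ (Wh (q i) ∧ d i = 0)) ∪
      ((S.filter fun i => q i + t * d i = 1) ∪ (S.filter fun i => q i = 0)) := by
    intro i hi
    simp only [mem_union, mem_filter, hi, true_and, mem_univ]
    by_cases hc : Wh (q i) ∧ d i = 0
    · right
      rcases hc.1 with c | c
      · right; exact c
      · left; simp [hc.2, c]
    · left; exact hc
  have h2 := (card_le_card hsub).trans (card_union_le _ _)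
  have h3 := card_union_le (S.filter fun i => q i + t * d i = 1) (S.filter fun i => q i = 0)
  unfold cnt at hzn hqn
  beta_reduce at hzn
  omega

def Good (ι J : Type) [Fintype ι] [Fintype J] (m : ℕ) (a : ℤ) : Prop :=
  ∀ (v : ι → Fin m → ℝ) (S : Finset ι), ∃ x : ι → J → ℝ,
    (∀ i j, 0 ≤ x i j) ∧ (∀ i, ∑ j, x i j = 1) ∧
    (∀ j, (Fintype.card J : ℝ) • ∑ i, x i j • v i = ∑ i, v i) ∧
    (∀ K : Finset ι, (∀ i ∈ K, ∀ j, x i j ≠ 1) → K.card + m ≤ Fintype.card J * m) ∧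
    ∀ (q : ℤ), Fintype.card J * q + a ≤ S.card → ∀ j, q ≤ cnt S (fun i => x i j) 1

lemma good_equiv {J J' : Type} [Fintype J] [Fintype J'] {m : ℕ} {a : ℤ} (e : J ≃ J')
    (h : Good ι J m a) : Good ι J' m a := by
  intro v S
  obtain ⟨x, h1, h2, h3, h4, h5⟩ := h v S
  have hc : Fintype.card J' = Fintype.card J := (Fintype.card_congr e).symm
  refine ⟨fun i j => x i (e.symm j), fun i j => h1 _ _, ?_, ?_, ?_, ?_⟩
  · intro i; rw [← h2 i]; exact Equiv.sum_comp e.symm (x i)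
  · intro j; rw [hc]; exact h3 _
  · intro K hK; rw [hc]; apply h4 K; intro i hi j; simpa using hK i hi (e j)
  · intro q hq j; rw [hc] at hq; exact h5 q hq _

lemma good_unit (m : ℕ) : Good ι Unit m 0 := by
  intro v S
  refine ⟨fun _ _ => 1, by simp, by simp, by simp, ?_, ?_⟩
  · intro K hK
    rcases K.eq_empty_or_nonempty with h | ⟨i, hi⟩
    · simp [h]
    · exact absurd rfl (hK i hi ())
  · intro q hq j
    simp [cnt] at hq ⊢
    exact hq

lemma good_sum {J₁ J₂ : Type} [Fintype J₁] [Fintype J₂] [Nonempty J₁] [Nonempty J₂]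
    {m : ℕ} {a₁ a₂ a : ℤ}
    (h₁ : Good ι J₁ m a₁) (h₂ : Good ι J₂ m a₂)
    (hs : ∀ (v : ι → Fin m → ℝ) (S : Finset ι), ∃ y : ι → ℝ, Box y ∧
      ∑ i, y i • v i = ((Fintype.card J₁ : ℝ) / (Fintype.card J₁ + Fintype.card J₂)) • ∑ i, v i ∧
      (∀ K : Finset ι, (∀ i ∈ K, ¬ Wh (y i)) → K.card ≤ m) ∧
      ∀ q : ℤ, (Fintype.card J₁ + Fintype.card J₂) * q + a ≤ S.card →
        Fintype.card J₁ * q + a₁ ≤ cnt S y 1 ∧ Fintype.card J₂ * q + a₂ ≤ cnt S y 0) :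
    Good ι (J₁ ⊕ J₂) m a := by
  classical
  intro v S
  obtain ⟨y, hb, hV, hK, hq⟩ := hs v S
  have c1 : (0 : ℝ) < Fintype.card J₁ := by exact_mod_cast Fintype.card_pos
  have c2 : (0 : ℝ) < Fintype.card J₂ := by exact_mod_cast Fintype.card_pos
  obtain ⟨x, x1, x2, x3, x4, x5⟩ := h₁ (fun i => y i • v i) (S.filter fun i => y i = 1)
  obtain ⟨z, z1, z2, z3, z4, z5⟩ := h₂ (fun i => (1 - y i) • v i) (S.filter fun i => y i = 0)
  refine ⟨fun i => Sum.elim (fun j => y i * x i j) (fun j => (1 - y i) * z i j), ?_, ?_, ?_, ?_, ?_⟩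
  · rintro i (j | j)
    · exact mul_nonneg (hb i).1 (x1 i j)
    · exact mul_nonneg (by linarith [(hb i).2]) (z1 i j)
  · intro i
    simp [Fintype.sum_sum_type, ← Finset.mul_sum, x2, z2]
  · have hV' : ∑ i, (1 - y i) • v i =
        ((Fintype.card J₂ : ℝ) / (Fintype.card J₁ + Fintype.card J₂)) • ∑ i, v i := by
      simp only [sub_smul, Finset.sum_sub_distrib, hV, one_smul]
      have e : ((Fintype.card J₂ : ℝ) / (Fintype.card J₁ + Fintype.card J₂)) =
          1 - (Fintype.card J₁ : ℝ) / (Fintype.card J₁ + Fintype.card J₂) := by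
        field_simp
        ring
      rw [e, sub_smul, one_smul]
    rintro (j | j)
    · have := x3 j
      rw [hV] at this
      simp only [Sum.elim_inl, Fintype.card_sum, Nat.cast_add]
      have e : ∑ i, (y i * x i j) • v i = (Fintype.card J₁ : ℝ)⁻¹ •
          (Fintype.card J₁ : ℝ) • ∑ i, x i j • y i • v i := by
        rw [smul_smul, inv_mul_cancel₀ c1.ne', one_smul]
        apply Finset.sum_congr rfl
        intro i _
        rw [smul_smul, mul_comm]
      rw [e, this, smul_smul, smul_smul]
      convert one_smul ℝ _ using 2
      field_simp
    · have := z3 j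
      rw [hV'] at this
      simp only [Sum.elim_inr, Fintype.card_sum, Nat.cast_add]
      have e : ∑ i, ((1 - y i) * z i j) • v i = (Fintype.card J₂ : ℝ)⁻¹ •
          (Fintype.card J₂ : ℝ) • ∑ i, z i j • (1 - y i) • v i := by
        rw [smul_smul, inv_mul_cancel₀ c2.ne', one_smul]
        apply Finset.sum_congr rfl
        intro i _
        rw [smul_smul, mul_comm]
      rw [e, this, smul_smul, smul_smul]
      convert one_smul ℝ _ using 2
      field_simp
  · intro K hKK
    have k0 := hK (K.filter fun i => ¬ Wh (y i)) (by intro i hi; exact (mem_filter.mp hi).2)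
    have k1 := x4 (K.filter fun i => y i = 1) (by
      intro i hi j hj
      rw [mem_filter] at hi
      apply hKK i hi.1 (Sum.inl j)
      simp [hi.2, hj])
    have k2 := z4 (K.filter fun i => y i = 0) (by
      intro i hi j hj
      rw [mem_filter] at hi
      apply hKK i hi.1 (Sum.inr j)
      simp [hi.2, hj])
    have : K ⊆ (K.filter fun i => y i = 1) ∪ (K.filter fun i => y i = 0) ∪
        (K.filter fun i => ¬ Wh (y i)) := by
      intro i hi
      simp only [mem_union, mem_filter, hi, true_and]
      unfold Wh
      tauto
    have h2 := (card_le_card this).trans (card_union_le _ _)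
    have h3 := card_union_le (K.filter fun i => y i = 1) (K.filter fun i => y i = 0)
    rw [Fintype.card_sum, add_mul]
    omega
  · intro q hqq
    rw [Fintype.card_sum] at hqq
    obtain ⟨q1, q2⟩ := hq q (by push_cast at hqq; exact hqq)
    rintro (j | j)
    · refine (x5 q q1 j).trans ?_
      unfold cnt
      exact_mod_cast card_le_card (by
        intro i hi
        simp only [mem_filter] at hi ⊢
        simp [hi])
    · refine (z5 q q2 j).trans ?_
      unfold cnt
      exact_mod_cast card_le_card (by
        intro i hi
        simp only [mem_filter] at hi ⊢
        simp [hi])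

lemma good_double {J : Type} [Fintype J] [Nonempty J] {m : ℕ} {a : ℤ} (h : Good ι J m a) :
    Good ι (J ⊕ J) m (m + 2 * a) := by
  apply good_sum h h
  intro v S
  have c1 : (0 : ℝ) < Fintype.card J := by exact_mod_cast Fintype.card_pos
  obtain ⟨y, hy, h1, h2⟩ := split_bal v S (((S.card : ℤ) - m) / 2) (by
    rw [Fintype.card_fin]; omega)
  refine ⟨y, hy.1, ?_, ?_, ?_⟩
  · rw [hy.2.1]; congr 1; field_simp; ring
  · intro K hK; simpa using hy.2.2.card_le K hK
  · intro q hq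
    have : (Fintype.card J : ℤ) * q + a ≤ ((S.card : ℤ) - m) / 2 := by
      rw [Int.le_ediv_iff_mul_le (by norm_num)]
      linarith
    exact ⟨this.trans h1, this.trans h2⟩

lemma good_succ {J : Type} [Fintype J] [Nonempty J] {m : ℕ} {a b : ℤ} (h : Good ι J m a)
    (hb1 : (1 + Fintype.card J : ℤ) * m ≤ b)
    (hb2 : (1 + Fintype.card J : ℤ) * (m + a) ≤ Fintype.card J * b) :
    Good ι (Unit ⊕ J) m b := by
  apply good_sum (good_unit m) h
  intro v S
  have c1 : (0 : ℝ) < Fintype.card J := by exact_mod_cast Fintype.card_pos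
  have c1' : (0 : ℤ) < Fintype.card J := by exact_mod_cast Fintype.card_pos
  simp only [Fintype.card_unit, Nat.cast_one]
  obtain ⟨y, hy1, hy2, hy3, hy4⟩ := split_unbal v S (1 / (1 + Fintype.card J)) (by positivity) (by
    rw [div_le_one (by positivity)]; linarith)
  refine ⟨y, hy1, hy2, ?_, ?_⟩
  · intro K hK; simpa using hy3 K hK
  · obtain ⟨t1, t0⟩ := hy4 (S.filter fun i => y i = 1) (S.filter fun i => y i = 0)
      (by intro i hi h; simp [hi, h]) (by intro i hi h; simp [hi, h])
    change _ < (cnt S y 1 : ℝ) + _ + 1 at t1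
    change _ < (cnt S y 0 : ℝ) + _ + 1 at t0
    rw [Fintype.card_fin] at t1 t0
    have e0 : (1 : ℝ) - 1 / (1 + Fintype.card J) = Fintype.card J / (1 + Fintype.card J) := by
      field_simp; ring
    rw [e0, div_mul_eq_mul_div, div_lt_iff₀ (by positivity)] at t0
    rw [div_mul_eq_mul_div, div_lt_iff₀ (by positivity)] at t1
    have t1' : (1 : ℤ) * S.card < (cnt S y 1 + m + 1) * (1 + Fintype.card J) := by exact_mod_cast t1
    have t0' : (Fintype.card J : ℤ) * S.card < (cnt S y 0 + m + 1) * (1 + Fintype.card J) := by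
      exact_mod_cast t0
    intro q hq
    generalize (Fintype.card J : ℤ) = s at *
    generalize (cnt S y 1 : ℤ) = w1 at *
    generalize (cnt S y 0 : ℤ) = w0 at *
    generalize (S.card : ℤ) = N at *
    constructor
    · have : (1 + s) * q < (1 + s) * (w1 + 1) := by nlinarith
      have := lt_of_mul_lt_mul_left this (by linarith)
      linarith
    · have h5 : s * ((1 + s) * q + b) ≤ s * N := mul_le_mul_of_nonneg_left hq c1'.le
      have : (1 + s) * (s * q + a) < (1 + s) * (w0 + 1) := by nlinarith
      have := lt_of_mul_lt_mul_left this (by linarith)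
      linarith

/-- the constant in the recursion -/
def cc (r m : ℕ) : ℤ := if Even r then (2 * r - 3) * m else (2 * r - 2) * m

lemma good_all (m : ℕ) (r : ℕ) (hr : 0 < r) : Good ι (Fin r) m (cc r m) := by
  induction r using Nat.strong_induction_on with
  | _ r ih =>
  rcases Nat.even_or_odd' r with ⟨s, rfl | rfl⟩
  · have hs : 0 < s := by omega
    haveI : Nonempty (Fin s) := ⟨⟨0, hs⟩⟩
    have h0 := ih s (by omega) hs
    -- weaken the constant to the odd one
    have h1 : Good ι (Fin s) m ((2 * s - 2) * m) := by
      intro v S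
      obtain ⟨x, x1, x2, x3, x4, x5⟩ := h0 v S
      refine ⟨x, x1, x2, x3, x4, fun q hq => x5 q (le_trans ?_ hq)⟩
      unfold cc
      split_ifs
      · nlinarith
      · exact le_rfl
    have h2 := good_double h1
    have h3 := good_equiv (finSumFinEquiv.trans (finCongr (by omega : s + s = 2 * s))) h2
    convert h3 using 1
    simp [cc]
    ring
  · rcases Nat.eq_zero_or_pos s with rfl | hs
    · have := good_equiv (ι := ι) (Equiv.ofUnique Unit (Fin 1)) (good_unit m)
      simpa [cc] using this
    · haveI : Nonempty (Fin (2 * s)) := ⟨⟨0, by omega⟩⟩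
      have h0 := ih (2 * s) (by omega) (by omega)
      have e : cc (2 * s) m = (4 * s - 3) * m := by
        simp [cc]; left; ring
      rw [e] at h0
      have hs' : (1 : ℤ) ≤ s := by exact_mod_cast hs
      have hm' : (0 : ℤ) ≤ m := by positivity
      have h2 := good_succ (b := (4 * s) * m) h0 (by
        simp; nlinarith) (by
        simp; nlinarith)
      have h3 := good_equiv ((Equiv.sumCongr (Equiv.ofUnique Unit (Fin 1)) (Equiv.refl _)).trans
        (finSumFinEquiv.trans (finCongr (by omega : 1 + 2 * s = 2 * s + 1)))) h2
      convert h3 using 1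
      simp [cc]
      left; ring

lemma final_arith (r m : ℕ) (hr : 0 < r) (hm : 0 < m) :
    cc r m ≤ ⌈((m * (r - 1) : ℕ) : ℚ) / 2⌉ + r * ⌊((m * (r - 1) : ℕ) : ℚ) / 2⌋ := by
  obtain ⟨k, rfl⟩ : ∃ k, r = k + 1 := ⟨r - 1, by omega⟩
  simp only [Nat.add_sub_cancel]
  set M := m * k with hM
  have hf1 : ⌊(M : ℚ) / 2⌋ ≤ (M : ℚ) / 2 := Int.floor_le _
  have hf2 : (M : ℚ) / 2 < ⌊(M : ℚ) / 2⌋ + 1 := Int.lt_floor_add_one _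
  have hc1 : (M : ℚ) / 2 ≤ ⌈(M : ℚ) / 2⌉ := Int.le_ceil _
  generalize ⌊(M : ℚ) / 2⌋ = f at *
  generalize ⌈(M : ℚ) / 2⌉ = c at *
  have g2 : (M : ℤ) < 2 * f + 2 := by
    have : (M : ℚ) < 2 * f + 2 := by linarith
    exact_mod_cast this
  have g1 : (2 : ℤ) * f ≤ M := by
    have : (2 : ℚ) * f ≤ M := by linarith
    exact_mod_cast this
  have g3 : (M : ℤ) ≤ 2 * c := by
    have : (M : ℚ) ≤ 2 * c := by linarith
    exact_mod_cast this
  have hMz : (M : ℤ) = m * k := by rw [hM]; push_cast; ring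
  have hm' : (1 : ℤ) ≤ m := by exact_mod_cast hm
  have hk' : (0 : ℤ) ≤ k := by positivity
  unfold cc
  push_cast
  split_ifs with hev
  · -- k odd
    have hk1 : 1 ≤ k := by
      rcases Nat.eq_zero_or_pos k with rfl | h
      · simp at hev
      · exact h
    rcases Nat.lt_or_ge k 2 with h | h
    · obtain rfl : k = 1 := by omega
      push_cast at *
      omega
    · have h3 : (3 : ℤ) ≤ k := by
        have : k ≠ 2 := by rintro rfl; exact absurd hev (by decide)
        have : 3 ≤ k := by omega
        exact_mod_cast this
      nlinarith
  · have hMe : Even M := by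
      rw [hM]; apply Even.mul_left
      by_contra h
      exact hev (Odd.add_one (Nat.not_even_iff_odd.mp h))
    obtain ⟨u, hu⟩ := hMe
    have hf : f = u := by omega
    have hcu : (u : ℤ) ≤ c := by omega
    rcases Nat.lt_or_ge k 2 with h | h
    · have : k = 0 := by
        by_contra h0
        have : k = 1 := by omega
        subst this; exact hev (by decide)
      subst this
      push_cast at *
      simp at hMz
      omega
    · have h2 : (2 : ℤ) ≤ k := by exact_mod_cast h
      subst hf
      have : (m : ℤ) * k = 2 * u := by rw [← hMz, hu]; push_cast; ring
      nlinarith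

end Cookie

/-- Main cookie-splitting theorem: `n` cookies, each an `m`-tuple of nonnegative reals, can be
distributed among `r` children, cutting at most `(r-1)*m` cookies, so that every child gets
exactly `1/r` of each frosting kind and at least
`⌊(n - ⌈m(r-1)/2⌉)/r⌋ - ⌊m(r-1)/2⌋` whole cookies. -/
theorem cookie_splitting (r n m : ℕ) (hr : 0 < r) (hn : 0 < n) (hm : 0 < m)
    (v : Fin n → Fin m → ℝ) (hv : ∀ i j, 0 ≤ v i j) :
    ∃ (w : Fin n → Fin r → Fin m → ℝ) (C : Finset (Fin n)) (owner : Fin n → Fin r),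
      (∀ i j k, 0 ≤ w i j k) ∧
      (∀ i, ∑ j : Fin r, w i j = v i) ∧
      (∀ i ∉ C, ∀ j, w i j = if j = owner i then v i else 0) ∧
      C.card ≤ (r - 1) * m ∧
      (∀ j : Fin r, (r : ℝ) • ∑ i, w i j = ∑ i, v i) ∧
      (∀ j : Fin r,
        ⌊(((n : ℚ) - ⌈((m * (r - 1) : ℕ) : ℚ) / 2⌉) / r)⌋ - ⌊((m * (r - 1) : ℕ) : ℚ) / 2⌋
          ≤ ((Finset.univ.filter fun i => i ∉ C ∧ owner i = j).card : ℤ)) := by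
  classical
  obtain ⟨x, x1, x2, x3, x4, x5⟩ := Cookie.good_all (ι := Fin n) m r hr v Finset.univ
  have huniq : ∀ i j, x i j = 1 → ∀ j', x i j' = if j' = j then 1 else 0 := by
    intro i j hj j'
    split_ifs with h
    · rw [h, hj]
    · have h2 := x2 i
      rw [← Finset.add_sum_erase _ _ (Finset.mem_univ j), hj] at h2
      have h3 : ∑ k ∈ Finset.univ.erase j, x i k = 0 := by linarith
      rw [Finset.sum_eq_zero_iff_of_nonneg (fun k _ => x1 i k)] at h3
      exact h3 j' (by simp [h])
  let owner : Fin n → Fin r := fun i => if h : ∃ j, x i j = 1 then h.choose else ⟨0, hr⟩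
  have hown : ∀ i, (∃ j, x i j = 1) → x i (owner i) = 1 := by
    intro i h
    simp only [owner, dif_pos h]
    exact h.choose_spec
  refine ⟨fun i j => x i j • v i, Finset.univ.filter fun i => ∀ j, x i j ≠ 1, owner,
    ?_, ?_, ?_, ?_, ?_, ?_⟩
  · intro i j k
    exact mul_nonneg (x1 i j) (hv i k)
  · intro i
    rw [← Finset.sum_smul, x2, one_smul]
  · intro i hi j
    have hi' : ∃ j, x i j = 1 := by simpa using hi
    show x i j • v i = _
    rw [huniq i _ (hown i hi') j]
    split_ifs <;> simp
  · have := x4 (Finset.univ.filter fun i => ∀ j, x i j ≠ 1) (by simp)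
    rw [Fintype.card_fin] at this
    rw [Nat.sub_mul, one_mul]
    omega
  · intro j
    have := x3 j
    rwa [Fintype.card_fin] at this
  · intro j
    have ha := Cookie.final_arith r m hr hm
    refine (x5 _ ?_ j).trans ?_
    · simp only [Fintype.card_fin, Finset.card_univ]
      have hr' : (0 : ℚ) < r := by exact_mod_cast hr
      have hfl := Int.floor_le ((((n : ℚ) - ⌈((m * (r - 1) : ℕ) : ℚ) / 2⌉) / r))
      rw [le_div_iff₀ hr'] at hfl
      generalize ⌊(((n : ℚ) - ⌈((m * (r - 1) : ℕ) : ℚ) / 2⌉) / r)⌋ = Y at *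
      generalize ⌊((m * (r - 1) : ℕ) : ℚ) / 2⌋ = f at *
      generalize ⌈((m * (r - 1) : ℕ) : ℚ) / 2⌉ = c at *
      have hz : Y * r ≤ (n : ℤ) - c := by exact_mod_cast hfl
      nlinarith
    · unfold Cookie.cnt
      exact_mod_cast Finset.card_le_card (by
        intro i hi
        simp only [Finset.mem_filter, Finset.mem_univ, true_and] at hi ⊢
        refine ⟨fun h => h j hi, ?_⟩
        have h1 := hown i ⟨j, hi⟩
        rw [huniq i j hi] at h1
        by_contra hne
        simp [hne] at h1)
end
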